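/- Let b₂, b₃ ∈ {1, 3} and b be an integer with c := 4b + 2 + b₂ + b₃ > 0. Let G be the group with presentation ⟨s₁, s₂, s₃, h | [sᵢ,h] for i = 1,2,3, s₁²h, s₂⁴h^{b₂}, s₃⁴h^{b₃}, s₁s₂s₃h^{-b}⟩. Then the abelianization of G is isomorphic to ℤ/2 ⊕ ℤ/(4c). -/

import Mathlib

/-- Relations of the fundamental group of `M_244(b,b₂,b₃)`:
generators `s₁ = 0`, `s₂ = 1`, `s₃ = 2`, `h = 3`;
relations `[sᵢ,h]` (`i = 1,2,3`), `s₁²h`, `s₂⁴h^{b₂}`, `s₃⁴h^{b₃}`, `s₁s₂s₃h^{-b}`. -/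
def rels244 (b b₂ b₃ : ℤ) : Set (FreeGroup (Fin 4)) :=
  { r | (∃ i : Fin 3, r = .of i.castSucc * .of 3 * (.of i.castSucc)⁻¹ * (.of 3)⁻¹) ∨
        r = .of 0 * .of 0 * .of 3 ∨
        r = (.of 1) ^ (4 : ℤ) * (.of 3) ^ b₂ ∨
        r = (.of 2) ^ (4 : ℤ) * (.of 3) ^ b₃ ∨
        r = .of 0 * .of 1 * .of 2 * (.of 3) ^ (-b) }

/-- The relations of `rels244`, written additively in the abelianization. -/
theorem additive_relations_M244 (b b₂ b₃ : ℤ) :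
    let x : Fin 4 → Additive (Abelianization (PresentedGroup (rels244 b b₂ b₃))) :=
      fun i => Additive.ofMul (Abelianization.of (PresentedGroup.of i))
    2 • x 0 + x 3 = 0 ∧ (4 : ℤ) • x 1 + b₂ • x 3 = 0 ∧ (4 : ℤ) • x 2 + b₃ • x 3 = 0 ∧
      x 0 + x 1 + x 2 + (-b) • x 3 = 0 := by
  intro x
  let q : FreeGroup (Fin 4) →* Abelianization (PresentedGroup (rels244 b b₂ b₃)) :=
    Abelianization.of.comp (PresentedGroup.mk _)
  have hq : ∀ r ∈ rels244 b b₂ b₃, Additive.ofMul (q r) = 0 := fun r hr => by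
    have h : PresentedGroup.mk (rels244 b b₂ b₃) r = 1 := PresentedGroup.one_of_mem hr
    simp [q, h]
  have hx : ∀ i, Additive.ofMul (q (.of i)) = x i := fun _ => rfl
  refine ⟨?_, ?_, ?_, ?_⟩
  · simpa [hx, two_nsmul] using hq (.of 0 * .of 0 * .of 3) (Or.inr (Or.inl rfl))
  · simpa only [map_mul, map_zpow, ofMul_mul, ofMul_zpow, hx] using
      hq ((.of 1) ^ (4 : ℤ) * (.of 3) ^ b₂) (Or.inr (Or.inr (Or.inl rfl)))
  · simpa only [map_mul, map_zpow, ofMul_mul, ofMul_zpow, hx] using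
      hq ((.of 2) ^ (4 : ℤ) * (.of 3) ^ b₃) (Or.inr (Or.inr (Or.inr (Or.inl rfl))))
  · simpa only [map_mul, map_zpow, ofMul_mul, ofMul_zpow, hx] using
      hq (.of 0 * .of 1 * .of 2 * (.of 3) ^ (-b)) (Or.inr (Or.inr (Or.inr (Or.inr rfl))))

/-- The homomorphism `ℤ/m × ℤ/n → A` given by elements `t` and `z` killed by `m` and `n`. -/
theorem exists_hom_zmod_prod {A : Type*} [AddCommGroup A] (m n : ℕ) (t z : A)
    (ht : (m : ℤ) • t = 0) (hz : (n : ℤ) • z = 0) :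
    ∃ g : ZMod m × ZMod n →+ A, ∀ i j : ℤ, g (i, j) = i • t + j • z := by
  refine ⟨(ZMod.lift m ⟨zmultiplesHom A t, by simpa using ht⟩).coprod
    (ZMod.lift n ⟨zmultiplesHom A z, by simpa using hz⟩), fun i j => ?_⟩
  simp

theorem abelianization_M244 (b b₂ b₃ : ℤ) (h₂ : b₂ = 1 ∨ b₂ = 3) (h₃ : b₃ = 1 ∨ b₃ = 3)
    (hc : 0 < 4 * b + 2 + b₂ + b₃) :
    Nonempty (Abelianization (PresentedGroup (rels244 b b₂ b₃)) ≃*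
      Multiplicative (ZMod 2 × ZMod (4 * (4 * b + 2 + b₂ + b₃)).toNat)) := by
  obtain ⟨k, hk⟩ : ∃ k : ℤ, b₂ = 2 * k + 1 := by
    rcases h₂ with rfl | rfl
    exacts [⟨0, rfl⟩, ⟨1, rfl⟩]
  obtain ⟨n, hn⟩ : ∃ n : ℕ, n = (4 * (4 * b + 2 + b₂ + b₃)).toNat := ⟨_, rfl⟩
  rw [← hn]
  have hn' : (n : ℤ) = 4 * (4 * b + 2 + b₂ + b₃) := by omega
  clear hn hc
  obtain ⟨e₁, e₂, e₃, e₄⟩ := additive_relations_M244 b b₂ b₃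
  set x : Fin 4 → Additive (Abelianization (PresentedGroup (rels244 b b₂ b₃))) :=
    fun i => Additive.ofMul (Abelianization.of (PresentedGroup.of i)) with hx
  have ht : ((2 : ℕ) : ℤ) • ((2 : ℤ) • x 1 - b₂ • x 0) = 0 := by
    linear_combination (norm := module) e₂ - b₂ • e₁
  have ha : (2 * (4 * b + 2 + b₂ + b₃)) • x 0 = 0 := by
    linear_combination (norm := module) (4 * b + b₂ + b₃) • e₁ - e₂ - e₃ + (4 : ℤ) • e₄
  have hz : (n : ℤ) • (x 1 - k • x 0) = 0 := by
    rw [hn']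
    subst hk
    linear_combination (norm := module)
      (4 * b + 2 + (2 * k + 1) + b₃) • (e₂ - (2 * k + 1) • e₁) + ha
  obtain ⟨g, hg⟩ := exists_hom_zmod_prod 2 n _ _ ht hz
  let p : Fin 4 → ℤ := ![1, k, 1 + k, 0]
  let q : Fin 4 → ℤ := ![2, b₂, -(4 * b + 2) - b₂, -4]
  let v : Fin 4 → ZMod 2 × ZMod n := fun i => (p i, q i)
  have hnz : (4 * (4 * b + 2 + b₂ + b₃) : ZMod n) = 0 := by
    have := congrArg (Int.cast : ℤ → ZMod n) hn'
    push_cast at this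
    simpa using this.symm
  have h2 : (2 : ZMod 2) = 0 := rfl
  have hv : ∀ r ∈ rels244 b b₂ b₃,
      FreeGroup.lift (fun i => Multiplicative.ofAdd (v i)) r = 1 := by
    rintro r (⟨i, rfl⟩ | rfl | rfl | rfl | rfl) <;> apply Multiplicative.toAdd.injective
    · simp
    all_goals ext <;> simp only [v, p, q] <;> simp [-mul_eq_zero]
    · linear_combination h2
    · ring
    · linear_combination 2 * k * h2
    · ring
    · linear_combination 2 * (1 + k) * h2
    · linear_combination -hnz
    · linear_combination (1 + k) * h2
    · ring
  let f : Abelianization (PresentedGroup (rels244 b b₂ b₃)) →* Multiplicative (ZMod 2 × ZMod n) :=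
    Abelianization.lift (PresentedGroup.toGroup hv)
  have hf : ∀ i, f (x i).toMul = Multiplicative.ofAdd (v i) := fun i => by
    simp [f, hx]
  have hgv : ∀ i, g (v i) = x i := fun i => by
    rw [hg]
    subst hk
    have E : (4 : ℤ) • x 1 - (2 * (2 * k + 1)) • x 0 = 0 := by
      linear_combination (norm := module) e₂ - (2 * k + 1) • e₁
    fin_cases i <;> simp only [p, q, Fin.zero_eta, Fin.mk_one, Fin.reduceFinMk, Matrix.cons_val]
    · linear_combination (norm := module) E
    · linear_combination (norm := module) k • E
    · linear_combination (norm := module) -b • e₁ - b • E - e₄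
    · linear_combination (norm := module) -e₁ - E
  have hfg : ∀ i j : ℤ, f (g (i, j)).toMul = Multiplicative.ofAdd ((i : ZMod 2), (j : ZMod n)) := by
    intro i j
    rw [hg]
    apply Multiplicative.toAdd.injective
    simp only [toMul_add, toMul_sub, toMul_zsmul, map_mul, map_div, map_zpow, hf]
    subst hk
    ext <;> simp [v, p, q]
    · ring
  refine ⟨MonoidHom.toMulEquiv f (AddMonoidHom.toMultiplicativeLeft g) ?_ ?_⟩
  · ext i
    change (g (f (x i).toMul).toAdd).toMul = (x i).toMul
    rw [hf]
    exact congrArg Additive.toMul (hgv i)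
  · refine MonoidHom.ext fun w => ?_
    obtain ⟨i, hi⟩ := ZMod.intCast_surjective w.toAdd.1
    obtain ⟨j, hj⟩ := ZMod.intCast_surjective w.toAdd.2
    have hw : w = Multiplicative.ofAdd ((i : ZMod 2), (j : ZMod n)) := by
      rw [hi, hj]; rfl
    rw [hw]
    exact hfg i j
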